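/- Let n be a positive integer and let W, T₂, S₁,₁,...,S₁,ₙ, S₂,₁,...,S₂,ₙ, Y₁,...,Yₙ be random variables with values in finite sets on a common probability space. Assume that for each i ∈ {1,...,n}, S₁,ᵢ and S₁^{i−1} = (S₁,₁,...,S₁,ᵢ₋₁) are conditionally independent given (T₂, S₂^{i−1}). Then Σ_{i=1}^n I( S₁,ᵢ ; (W, Y^{i−1}, S₁,ᵢ₊₁^n) | (T₂, S₂^{i−1}) ) ≤ Σ_{i=1}^n I( S₁,ᵢ ; (W, Y^{i−1}, S₂^{i−1}) | (T₂, S₁,ᵢ₊₁^n) ). -/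

import Mathlib

open scoped Classical

/-- The probability of the event `f = a` under the pmf `P` on a finite space. -/
noncomputable def pr {Ω A : Type*} [Fintype Ω] (P : Ω → ℝ) (f : Ω → A) (a : A) : ℝ :=
  ∑ ω, if f ω = a then P ω else 0

/-- Shannon entropy `H(f)` (convention `0 log 0 = 0`, automatic since `Real.log 0 = 0`). -/
noncomputable def ent {Ω A : Type*} [Fintype Ω] [Fintype A] (P : Ω → ℝ) (f : Ω → A) : ℝ :=
  -∑ a, pr P f a * Real.log (pr P f a)

/-- Mutual information `I(f;g) = H(f) + H(g) − H(f,g)`. -/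
noncomputable def mi {Ω A B : Type*} [Fintype Ω] [Fintype A] [Fintype B]
    (P : Ω → ℝ) (f : Ω → A) (g : Ω → B) : ℝ :=
  ent P f + ent P g - ent P (fun ω => (f ω, g ω))

/-- Conditional mutual information `I(f;g|h) = H(f,h) + H(g,h) − H(f,g,h) − H(h)`. -/
noncomputable def cmi {Ω A B C : Type*} [Fintype Ω] [Fintype A] [Fintype B] [Fintype C]
    (P : Ω → ℝ) (f : Ω → A) (g : Ω → B) (h : Ω → C) : ℝ :=
  ent P (fun ω => (f ω, h ω)) + ent P (fun ω => (g ω, h ω)) -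
    ent P (fun ω => (f ω, g ω, h ω)) - ent P h

/-- The prefix tuple `A^{i-1} = (A₁, …, A_{i−1})` of a finite sequence of random
variables (as a single random variable). -/
def pre {Ω A : Type*} {n : ℕ} (f : Fin n → Ω → A) (i : Fin n) :
    Ω → (Fin i.val → A) :=
  fun ω j => f ⟨j.val, j.isLt.trans i.isLt⟩ ω

/-- The suffix tuple `A_{i+1}^n = (A_{i+1}, …, A_n)` of a finite sequence of random
variables (as a single random variable). -/
def suf {Ω A : Type*} {n : ℕ} (f : Fin n → Ω → A) (i : Fin n) :
    Ω → (Fin (n - (i.val + 1)) → A) :=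
  fun ω j => f ⟨i.val + 1 + j.val, by have h1 := j.isLt; have h2 := i.isLt; omega⟩ ω

/-- Independence of two random variables on a finite pmf space. -/
def IndepRV {Ω A B : Type*} [Fintype Ω]
    (P : Ω → ℝ) (f : Ω → A) (g : Ω → B) : Prop :=
  ∀ a b, pr P (fun ω => (f ω, g ω)) (a, b) = pr P f a * pr P g b

/-- Conditional independence of `f` and `g` given `h` on a finite pmf space. -/
def CondIndepRV {Ω A B C : Type*} [Fintype Ω]
    (P : Ω → ℝ) (f : Ω → A) (g : Ω → B) (h : Ω → C) : Prop :=
  ∀ a b c,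
    pr P (fun ω => (f ω, g ω, h ω)) (a, b, c) * pr P h c =
      pr P (fun ω => (f ω, h ω)) (a, c) * pr P (fun ω => (g ω, h ω)) (b, c)

theorem pr_nonneg {Ω A : Type*} [Fintype Ω] {P : Ω → ℝ} (hP0 : ∀ ω, 0 ≤ P ω)
    (f : Ω → A) (a : A) : 0 ≤ pr P f a :=
  Finset.sum_nonneg fun ω _ => by split_ifs <;> simp [hP0]

theorem pr_pos_of_pos {Ω A : Type*} [Fintype Ω] {P : Ω → ℝ} (hP0 : ∀ ω, 0 ≤ P ω)
    (f : Ω → A) {ω : Ω} (hω : 0 < P ω) : 0 < pr P f (f ω) :=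
  Finset.sum_pos' (fun ω _ => by split_ifs <;> simp [hP0])
    ⟨ω, Finset.mem_univ _, by simpa using hω⟩

/-- Expectation of a function of `f`, computed on the sample space. -/
theorem sum_pr_mul {Ω A : Type*} [Fintype Ω] [Fintype A] (P : Ω → ℝ) (f : Ω → A)
    (φ : A → ℝ) : ∑ a, pr P f a * φ a = ∑ ω, P ω * φ (f ω) := by
  simp only [pr, Finset.sum_mul, ite_mul, zero_mul]
  rw [Finset.sum_comm]
  simp

theorem sum_pr_pair_left {Ω A C : Type*} [Fintype Ω] [Fintype A] (P : Ω → ℝ)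
    (f : Ω → A) (h : Ω → C) (c : C) :
    ∑ a, pr P (fun ω => (f ω, h ω)) (a, c) = pr P h c := by
  simp only [pr, Prod.mk.injEq, ite_and]
  rw [Finset.sum_comm]
  simp

theorem ent_eq_sum {Ω A : Type*} [Fintype Ω] [Fintype A] (P : Ω → ℝ) (f : Ω → A) :
    ent P f = -∑ ω, P ω * Real.log (pr P f (f ω)) := by
  rw [ent, sum_pr_mul P f fun a => Real.log (pr P f a)]

/-- Entropy depends only on the partition of the sample space induced by the variable. -/
theorem ent_congr {Ω A B : Type*} [Fintype Ω] [Fintype A] [Fintype B] (P : Ω → ℝ)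
    {f : Ω → A} {g : Ω → B} (h : ∀ ω ω', f ω = f ω' ↔ g ω = g ω') :
    ent P f = ent P g := by
  simp only [ent_eq_sum, pr, h]

theorem cmi_eq_sum {Ω A B C : Type*} [Fintype Ω] [Fintype A] [Fintype B] [Fintype C]
    (P : Ω → ℝ) (f : Ω → A) (g : Ω → B) (h : Ω → C) :
    cmi P f g h = -∑ ω, P ω *
      (Real.log (pr P (fun ω => (f ω, h ω)) (f ω, h ω)) +
        Real.log (pr P (fun ω => (g ω, h ω)) (g ω, h ω)) -
        Real.log (pr P (fun ω => (f ω, g ω, h ω)) (f ω, g ω, h ω)) -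
        Real.log (pr P h (h ω))) := by
  simp only [cmi, ent_eq_sum, mul_add, mul_sub, Finset.sum_add_distrib, Finset.sum_sub_distrib]
  ring

theorem cmi_nonneg {Ω A B C : Type*} [Fintype Ω] [Fintype A] [Fintype B] [Fintype C]
    {P : Ω → ℝ} (hP0 : ∀ ω, 0 ≤ P ω) (f : Ω → A) (g : Ω → B) (h : Ω → C) :
    0 ≤ cmi P f g h := by
  rw [cmi_eq_sum, Left.nonneg_neg_iff]
  set pac := pr P (fun ω => (f ω, h ω))
  set pbc := pr P (fun ω => (g ω, h ω))
  set pabc := pr P (fun ω => (f ω, g ω, h ω)) with hpabc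
  set pc := pr P h with hpc
  have hac : ∀ x, 0 ≤ pac x := pr_nonneg hP0 _
  have hbc : ∀ x, 0 ≤ pbc x := pr_nonneg hP0 _
  have hc : ∀ x, 0 ≤ pc x := pr_nonneg hP0 _
  let r : A × B × C → ℝ := fun x =>
    pac (x.1, x.2.2) * pbc (x.2.1, x.2.2) / (pabc x * pc x.2.2)
  have hlog : ∀ ω, P ω * (Real.log (pac (f ω, h ω)) + Real.log (pbc (g ω, h ω)) -
      Real.log (pabc (f ω, g ω, h ω)) - Real.log (pc (h ω))) ≤
      P ω * r (f ω, g ω, h ω) - P ω := by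
    intro ω
    rcases (hP0 ω).eq_or_lt with h0 | hpos
    · simp [← h0]
    have h1 : 0 < pac (f ω, h ω) := pr_pos_of_pos hP0 (fun ω => (f ω, h ω)) hpos
    have h2 : 0 < pbc (g ω, h ω) := pr_pos_of_pos hP0 (fun ω => (g ω, h ω)) hpos
    have h3 : 0 < pabc (f ω, g ω, h ω) :=
      pr_pos_of_pos hP0 (fun ω => (f ω, g ω, h ω)) hpos
    have h4 : 0 < pc (h ω) := pr_pos_of_pos hP0 h hpos
    rw [← mul_sub_one]
    refine mul_le_mul_of_nonneg_left ?_ hpos.le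
    rw [← Real.log_mul h1.ne' h2.ne', sub_sub, ← Real.log_mul h3.ne' h4.ne',
      ← Real.log_div (by positivity) (by positivity)]
    exact Real.log_le_sub_one_of_pos (by positivity)
  have hr : ∑ ω, P ω * r (f ω, g ω, h ω) ≤ ∑ ω, P ω := by
    rw [← sum_pr_mul P (fun ω => (f ω, g ω, h ω)) r, ← hpabc]
    calc ∑ x, pabc x * r x
        ≤ ∑ x : A × B × C, pac (x.1, x.2.2) * (pbc (x.2.1, x.2.2) / pc x.2.2) := by
          refine Finset.sum_le_sum fun x _ => ?_
          rcases eq_or_ne (pabc x) 0 with h0 | h0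
          · rw [h0, zero_mul]
            exact mul_nonneg (hac _) (div_nonneg (hbc _) (hc _))
          · refine le_of_eq ?_
            simp only [r]
            rw [← mul_div_assoc, mul_div_mul_left _ _ h0, mul_div_assoc]
      _ = ∑ c, pc c := by
          have hsum : ∀ y : B × C, ∑ a, pac (a, y.2) * (pbc (y.1, y.2) / pc y.2) =
              pc y.2 * (pbc (y.1, y.2) / pc y.2) := fun y => by
            rw [← Finset.sum_mul, sum_pr_pair_left P f h]
          rw [Fintype.sum_prod_type_right, Finset.sum_congr rfl fun y _ => hsum y,
            Fintype.sum_prod_type_right]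
          refine Finset.sum_congr rfl fun c _ => ?_
          simp only
          rw [← Finset.mul_sum, ← Finset.sum_div, sum_pr_pair_left P g h, ← hpc,
            mul_div_assoc', mul_self_div_self]
      _ = ∑ ω, P ω := by simpa using sum_pr_mul P h fun _ => 1
  calc _ ≤ ∑ ω, (P ω * r (f ω, g ω, h ω) - P ω) := Finset.sum_le_sum fun ω _ => hlog ω
    _ ≤ 0 := by rw [Finset.sum_sub_distrib]; exact sub_nonpos.2 hr

theorem CondIndepRV.cmi_eq_zero {Ω A B C : Type*} [Fintype Ω] [Fintype A] [Fintype B]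
    [Fintype C] {P : Ω → ℝ} (hP0 : ∀ ω, 0 ≤ P ω) {f : Ω → A} {g : Ω → B} {h : Ω → C}
    (hCI : CondIndepRV P f g h) : cmi P f g h = 0 := by
  rw [cmi_eq_sum, neg_eq_zero]
  refine Finset.sum_eq_zero fun ω _ => ?_
  rcases (hP0 ω).eq_or_lt with h0 | hpos
  · simp [← h0]
  have h1 := pr_pos_of_pos hP0 (fun ω => (f ω, h ω)) hpos
  have h2 := pr_pos_of_pos hP0 (fun ω => (g ω, h ω)) hpos
  have h3 := pr_pos_of_pos hP0 (fun ω => (f ω, g ω, h ω)) hpos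
  have h4 := pr_pos_of_pos hP0 h hpos
  rw [← Real.log_mul h1.ne' h2.ne', sub_sub, ← Real.log_mul h3.ne' h4.ne', hCI, sub_self,
    mul_zero]

theorem pre_eq_iff {Ω A : Type*} {n : ℕ} (f : Fin n → Ω → A) (i : Fin n) (ω ω' : Ω) :
    pre f i ω = pre f i ω' ↔ ∀ j, j.val < i.val → f j ω = f j ω' :=
  ⟨fun h j hj => congrFun h ⟨j, hj⟩, fun h => funext fun j => h ⟨j, j.2.trans i.2⟩ j.2⟩

theorem suf_eq_iff {Ω A : Type*} {n : ℕ} (f : Fin n → Ω → A) (i : Fin n) (ω ω' : Ω) :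
    suf f i ω = suf f i ω' ↔ ∀ j, i.val + 1 ≤ j.val → f j ω = f j ω' := by
  refine ⟨fun h j hj => ?_, fun h => funext fun j => h _ (Nat.le_add_right _ _)⟩
  have := congrFun h ⟨j - (i + 1), by omega⟩
  simpa only [suf, Nat.add_sub_cancel' hj] using this

/-- The components of `f` whose index satisfies `p`, the others being erased. -/
noncomputable def restr {Ω A : Type*} {n : ℕ} (p : ℕ → Prop) (f : Fin n → Ω → A) :
    Ω → Fin n → Option A :=
  fun ω j => if p j then some (f j ω) else none

theorem restr_eq_iff {Ω A : Type*} {n : ℕ} (p : ℕ → Prop) (f : Fin n → Ω → A) (ω ω' : Ω) :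
    restr p f ω = restr p f ω' ↔ ∀ j, p j.val → f j ω = f j ω' := by
  rw [funext_iff]
  refine forall_congr' fun j => ?_
  by_cases h : p j <;> simp [restr, h]

theorem forall_val_lt_succ_iff {n : ℕ} (q : Fin n → Prop) (i : Fin n) :
    (∀ j : Fin n, j.val < i.val + 1 → q j) ↔ q i ∧ ∀ j : Fin n, j.val < i.val → q j := by
  refine ⟨fun h => ⟨h i (by omega), fun j hj => h j (by omega)⟩, fun h j hj => ?_⟩
  rcases eq_or_ne j i with rfl | hne
  · exact h.1
  · exact h.2 j (by have := Fin.val_ne_of_ne hne; omega)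

theorem forall_val_le_iff {n : ℕ} (q : Fin n → Prop) (i : Fin n) :
    (∀ j : Fin n, i.val ≤ j.val → q j) ↔ q i ∧ ∀ j : Fin n, i.val + 1 ≤ j.val → q j := by
  refine ⟨fun h => ⟨h i le_rfl, fun j hj => h j (by omega)⟩, fun h j hj => ?_⟩
  rcases eq_or_ne j i with rfl | hne
  · exact h.1
  · exact h.2 j (by have := Fin.val_ne_of_ne hne; omega)

/-- Both orders of the chain rule for `H(S₁, …, Sₙ | T)` give the same value. -/
theorem sum_ent_suf_sub_eq_sum_ent_pre_sub {Ω T A : Type*} [Fintype Ω] [Fintype T] [Fintype A]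
    {n : ℕ} (P : Ω → ℝ) (t : Ω → T) (S : Fin n → Ω → A) :
    ∑ i, (ent P (fun ω => (S i ω, t ω, suf S i ω)) - ent P (fun ω => (t ω, suf S i ω))) =
      ∑ i, (ent P (fun ω => (S i ω, pre S i ω, t ω)) - ent P (fun ω => (pre S i ω, t ω))) := by
  let F : ℕ → ℝ := fun k => ent P (fun ω => (t ω, restr (k ≤ ·) S ω))
  let G : ℕ → ℝ := fun k => ent P (fun ω => (t ω, restr (· < k) S ω))
  have hF : ∀ i : Fin n, ent P (fun ω => (S i ω, t ω, suf S i ω)) -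
      ent P (fun ω => (t ω, suf S i ω)) = F i - F (i + 1) := fun i => by
    congr 1 <;> refine ent_congr P fun ω ω' => ?_
    · simp only [Prod.mk.injEq, suf_eq_iff, restr_eq_iff, forall_val_le_iff]
      tauto
    · simp only [Prod.mk.injEq, suf_eq_iff, restr_eq_iff]
  have hG : ∀ i : Fin n, ent P (fun ω => (S i ω, pre S i ω, t ω)) -
      ent P (fun ω => (pre S i ω, t ω)) = G (i + 1) - G i := fun i => by
    congr 1 <;> refine ent_congr P fun ω ω' => ?_
    · simp only [Prod.mk.injEq, pre_eq_iff, restr_eq_iff, forall_val_lt_succ_iff]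
      tauto
    · simp only [Prod.mk.injEq, pre_eq_iff, restr_eq_iff, and_comm]
  have h0 : F 0 = G n := ent_congr P fun ω ω' => by simp [restr_eq_iff]
  have hn : F n = G 0 := ent_congr P fun ω ω' => by
    simp only [Prod.mk.injEq, restr_eq_iff, Nat.not_lt_zero, false_imp_iff, implies_true]
    refine and_congr_right fun _ => iff_true_intro fun j hj => absurd j.2 (by omega)
  rw [Finset.sum_congr rfl fun i _ => hF i, Finset.sum_congr rfl fun i _ => hG i,
    Fin.sum_univ_eq_sum_range (fun k => F k - F (k + 1)),
    Fin.sum_univ_eq_sum_range (fun k => G (k + 1) - G k), Finset.sum_range_sub',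
    Finset.sum_range_sub, h0, hn]

/-- Conditioning on `u` in addition cannot increase `H(f | g, t)`, while conditional independence
removes `g`, so `H(f | t, u) ≤ H(f | g, t)`. -/
theorem CondIndepRV.ent_sub_le {Ω A B C D : Type*} [Fintype Ω] [Fintype A] [Fintype B]
    [Fintype C] [Fintype D] {P : Ω → ℝ} (hP0 : ∀ ω, 0 ≤ P ω) {f : Ω → A} {g : Ω → B}
    {t : Ω → C} {u : Ω → D} (hCI : CondIndepRV P f g (fun ω => (t ω, u ω))) :
    ent P (fun ω => (f ω, t ω, u ω)) - ent P (fun ω => (t ω, u ω)) ≤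
      ent P (fun ω => (f ω, g ω, t ω)) - ent P (fun ω => (g ω, t ω)) := by
  have h1 := hCI.cmi_eq_zero hP0
  have h2 := cmi_nonneg hP0 f u (fun ω => (g ω, t ω))
  have h3 : ent P (fun ω => (u ω, g ω, t ω)) = ent P (fun ω => (g ω, t ω, u ω)) :=
    ent_congr P fun ω ω' => by simp only [Prod.mk.injEq]; tauto
  have h4 : ent P (fun ω => (f ω, u ω, g ω, t ω)) = ent P (fun ω => (f ω, g ω, t ω, u ω)) :=
    ent_congr P fun ω ω' => by simp only [Prod.mk.injEq]; tauto
  simp only [cmi] at h1 h2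
  linarith

/-- if for each `i` the variables `S₁,ᵢ` and `S₁^{i−1}` are conditionally
independent given `(T₂, S₂^{i−1})`, then
`Σᵢ I(S₁,ᵢ ; W, Y^{i−1}, S₁,ᵢ₊₁^n | T₂, S₂^{i−1}) ≤
 Σᵢ I(S₁,ᵢ ; W, Y^{i−1}, S₂^{i−1} | T₂, S₁,ᵢ₊₁^n)`. -/
theorem case2_csiszar_lemma {Ω Wt Tt A1 A2 Yt : Type*}
    [Fintype Ω] [Fintype Wt] [Fintype Tt] [Fintype A1] [Fintype A2] [Fintype Yt]
    {n : ℕ} (hn : 0 < n)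
    (P : Ω → ℝ) (hP0 : ∀ ω, 0 ≤ P ω) (hP1 : ∑ ω, P ω = 1)
    (W : Ω → Wt) (T2 : Ω → Tt)
    (S1 : Fin n → Ω → A1) (S2 : Fin n → Ω → A2) (Y : Fin n → Ω → Yt)
    (hCI : ∀ i : Fin n,
      CondIndepRV P (S1 i) (pre S1 i) (fun ω => (T2 ω, pre S2 i ω))) :
    ∑ i : Fin n,
        cmi P (S1 i) (fun ω => (W ω, pre Y i ω, suf S1 i ω))
          (fun ω => (T2 ω, pre S2 i ω)) ≤
      ∑ i : Fin n,
        cmi P (S1 i) (fun ω => (W ω, pre Y i ω, pre S2 i ω))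
          (fun ω => (T2 ω, suf S1 i ω)) := by
  have hdiff : ∀ i : Fin n,
      cmi P (S1 i) (fun ω => (W ω, pre Y i ω, pre S2 i ω)) (fun ω => (T2 ω, suf S1 i ω)) -
        cmi P (S1 i) (fun ω => (W ω, pre Y i ω, suf S1 i ω)) (fun ω => (T2 ω, pre S2 i ω)) =
      (ent P (fun ω => (S1 i ω, T2 ω, suf S1 i ω)) - ent P (fun ω => (T2 ω, suf S1 i ω))) -
        (ent P (fun ω => (S1 i ω, T2 ω, pre S2 i ω)) -
          ent P (fun ω => (T2 ω, pre S2 i ω))) := fun i => by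
    have h1 : ent P (fun ω => ((W ω, pre Y i ω, pre S2 i ω), T2 ω, suf S1 i ω)) =
        ent P (fun ω => ((W ω, pre Y i ω, suf S1 i ω), T2 ω, pre S2 i ω)) :=
      ent_congr P fun ω ω' => by simp only [Prod.mk.injEq]; tauto
    have h2 : ent P (fun ω => (S1 i ω, (W ω, pre Y i ω, pre S2 i ω), T2 ω, suf S1 i ω)) =
        ent P (fun ω => (S1 i ω, (W ω, pre Y i ω, suf S1 i ω), T2 ω, pre S2 i ω)) :=
      ent_congr P fun ω ω' => by simp only [Prod.mk.injEq]; tauto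
    simp only [cmi]
    linarith
  rw [← sub_nonneg, ← Finset.sum_sub_distrib, Finset.sum_congr rfl fun i _ => hdiff i,
    Finset.sum_sub_distrib, sub_nonneg, sum_ent_suf_sub_eq_sum_ent_pre_sub]
  exact Finset.sum_le_sum fun i _ => (hCI i).ent_sub_le hP0
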